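/- arXiv:2006.06138 — 4 statements merged into one kernel-verified Lean document; each statement's English description precedes it below -/
import Mathlib

section
/- Let v_1, …, v_{n+1} be real numbers and p_1, …, p_{n+1} be nonnegative reals summing to 1, and let β ∈ [0,1]. Then v_{n+1} ≤ Quantile(β; Σ_{i=1}^{n+1} p_i δ_{v_i}) if and only if v_{n+1} ≤ Quantile(β; Σ_{i=1}^{n} p_i δ_{v_i} + p_{n+1} δ_∞), where the latter distribution lives on ℝ ∪ {+∞}. -/
open scoped Classical

namespace ConformalCausal

/-- `Quantile β F` for a (sub-)probability distribution on `ℝ ∪ {+∞}` whose restriction to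
`ℝ` has "CDF ≥ β" region `S ⊆ ℝ`: it is `inf S`, computed in `EReal` so that it equals
`+∞` when `S = ∅` (and `−∞` when `S` is unbounded below). -/
noncomputable def Quantile (S : Set ℝ) : EReal :=
  sInf ((fun z : ℝ => (z : EReal)) '' S)

end ConformalCausal

/-- Lemma 1, Eq. (2), of Tibshirani et al. (2019), as used in the paper:
let `v₁, …, v_{n+1}` be reals and `p₁, …, p_{n+1}` nonnegative reals summing to `1`, and
let `β ∈ [0,1]`.  Then `v_{n+1} ≤ Quantile(β; Σ_{i=1}^{n+1} p_i δ_{v_i})` if and only if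
`v_{n+1} ≤ Quantile(β; Σ_{i=1}^{n} p_i δ_{v_i} + p_{n+1} δ_∞)`.  Here
`Quantile(β; F) = inf {z ∈ ℝ : F((−∞, z]) ≥ β}` (`+∞` if no such `z` exists); the point
mass `δ_∞` at `+∞` never contributes to `F((−∞, z])` for real `z`. -/
theorem quantile_delta_infty_iff {n : ℕ} (v p : Fin (n + 1) → ℝ)
    (hp : ∀ i, 0 ≤ p i) (hsum : ∑ i, p i = 1) (β : ℝ) (hβ : β ∈ Set.Icc (0 : ℝ) 1) :
    ((v (Fin.last n) : EReal) ≤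
        ConformalCausal.Quantile {z : ℝ | β ≤ ∑ i, if v i ≤ z then p i else 0}) ↔
      ((v (Fin.last n) : EReal) ≤
        ConformalCausal.Quantile
          {z : ℝ | β ≤ ∑ i : Fin n, if v i.castSucc ≤ z then p i.castSucc else 0}) := by
  have key : ∀ z : ℝ, z < v (Fin.last n) →
      (∑ i, if v i ≤ z then p i else 0) =
        ∑ i : Fin n, if v i.castSucc ≤ z then p i.castSucc else 0 := by
    intro z hz
    rw [Fin.sum_univ_castSucc, if_neg (not_le.mpr hz), add_zero]
  simp only [ConformalCausal.Quantile, le_sInf_iff, Set.forall_mem_image, Set.mem_setOf_eq,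
    EReal.coe_le_coe_iff]
  constructor
  · intro h z hz
    by_contra hlt
    exact hlt (h (by rw [key z (not_le.mp hlt)]; exact hz))
  · intro h z hz
    by_contra hlt
    exact hlt (h (by rw [← key z (not_le.mp hlt)]; exact hz))
end

section
/- Suppose the weight function used in weighted split-CQR is the true likelihood ratio, ŵ = w where w = dQ_X/dP_X. Then, with no further assumption, the interval Ĉ output by weighted split-CQR satisfies P_{(X,Y) ~ Q_X × P_{Y|X}}(Y ∈ Ĉ(X)) ≥ 1 − α, where the probability is over both the calibration sample and the independent test pair. -/
open MeasureTheory ProbabilityTheory ENNReal Filter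
open scoped Classical

namespace ConformalCausal

variable {𝒳 : Type*} [MeasurableSpace 𝒳]

/-- Non-conformity score `V = max (q̂_lo(x) − y, y − q̂_hi(x))` of a point `(x, y)`. -/
noncomputable def score (qlo qhi : 𝒳 → ℝ) (p : 𝒳 × ℝ) : ℝ :=
  max (qlo p.1 - p.2) (p.2 - qhi p.1)

/-- The set `{z ∈ ℝ : Σ_{i : V_i ≤ z} p̂_i(x) ≥ 1 − α}` whose infimum is the conformity
correction `η(x)`; here `p̂_i(x) = ŵ(X_i) / (Σ_j ŵ(X_j) + ŵ(x))` (computed in `ℝ≥0∞`, so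
that if `ŵ(x) = ∞` the set is empty, corresponding to `η(x) = +∞`). -/
noncomputable def qSet (α : ℝ) (w : 𝒳 → ℝ≥0∞) {n : ℕ}
    (d : Fin n → 𝒳 × ℝ) (qlo qhi : 𝒳 → ℝ) (x : 𝒳) : Set ℝ :=
  {z | ENNReal.ofReal (1 - α) ≤
      ∑ i, if score qlo qhi (d i) ≤ z
           then w (d i).1 / ((∑ j, w (d j).1) + w x) else 0}

/-- The weighted split-CQR interval `Ĉ(x) = [q̂_lo(x) − η(x), q̂_hi(x) + η(x)]`, equal to
all of `ℝ` when `η(x) = +∞` (i.e. when `qSet` is empty). -/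

noncomputable def Chat (α : ℝ) (w : 𝒳 → ℝ≥0∞) {n : ℕ}
    (d : Fin n → 𝒳 × ℝ) (qlo qhi : 𝒳 → ℝ) (x : 𝒳) : Set ℝ :=
  if (qSet α w d qlo qhi x).Nonempty then
    Set.Icc (qlo x - sInf (qSet α w d qlo qhi x))
            (qhi x + sInf (qSet α w d qlo qhi x))
  else Set.univ

end ConformalCausal

namespace ConformalCausal

lemma mem_Chat_iff {𝒳 : Type*} {α : ℝ} (hα : α < 1) (w : 𝒳 → ℝ≥0∞) {n : ℕ}
    (d : Fin n → 𝒳 × ℝ) (qlo qhi : 𝒳 → ℝ) (z : 𝒳 × ℝ) :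
    z.2 ∈ Chat α w d qlo qhi z.1 ↔
      ¬ (ENNReal.ofReal (1 - α) ≤ ∑ i, if score qlo qhi (d i) < score qlo qhi z
           then w (d i).1 / ((∑ j, w (d j).1) + w z.1) else 0) := by
  have hpos : 0 < ENNReal.ofReal (1 - α) := by simpa using hα
  have key : z.2 ∈ Chat α w d qlo qhi z.1 ↔
      ∀ t ∈ qSet α w d qlo qhi z.1, score qlo qhi z ≤ t := by
    unfold Chat
    split_ifs with hne
    · have hbdd : BddBelow (qSet α w d qlo qhi z.1) := by
        obtain ⟨m, hm⟩ := (Set.finite_range fun i => score qlo qhi (d i)).bddBelow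
        refine ⟨m, fun t ht => ?_⟩
        by_contra hlt
        push Not at hlt
        have hz : (∑ i, if score qlo qhi (d i) ≤ t
           then w (d i).1 / ((∑ j, w (d j).1) + w z.1) else 0) = 0 := by
          refine Finset.sum_eq_zero fun i _ => if_neg ?_
          have := hm (Set.mem_range_self i)
          linarith
        have h2 : ENNReal.ofReal (1 - α) ≤ _ := ht
        rw [hz] at h2
        exact absurd h2 (not_le.2 hpos)
      have := le_csInf_iff (a := score qlo qhi z) hbdd hne
      rw [← this, Set.mem_Icc]
      unfold score
      rw [max_le_iff]
      constructor <;> rintro ⟨h1, h2⟩ <;> constructor <;> linarith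
    · simp only [Set.mem_univ, true_iff]
      intro t ht
      exact absurd ⟨t, ht⟩ hne
  rw [key]
  constructor
  · intro h hB
    -- find t between
    have hfin : (Finset.univ.filter fun i => score qlo qhi (d i) < score qlo qhi z).Nonempty := by
      by_contra hemp
      rw [Finset.not_nonempty_iff_eq_empty] at hemp
      rw [← Finset.sum_filter, hemp] at hB
      simp only [Finset.sum_empty] at hB
      exact absurd hB (not_le.2 hpos)
    obtain ⟨k, hk, hmax⟩ := Finset.exists_max_image _ (fun i => score qlo qhi (d i)) hfin
    rw [Finset.mem_filter] at hk
    have : score qlo qhi (d k) ∈ qSet α w d qlo qhi z.1 := by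
      refine hB.trans (Finset.sum_le_sum fun i _ => ?_)
      by_cases hi : score qlo qhi (d i) < score qlo qhi z
      · rw [if_pos hi, if_pos (hmax i (by simp [hi]))]
      · rw [if_neg hi]; exact zero_le
    exact absurd (h _ this) (not_le.2 hk.2)
  · intro h t ht
    by_contra hlt
    push Not at hlt
    refine h (le_trans ht (Finset.sum_le_sum fun i _ => ?_))
    by_cases hi : score qlo qhi (d i) ≤ t
    · rw [if_pos hi, if_pos (hi.trans_lt hlt)]
    · rw [if_neg hi]; exact zero_le

/-- Deterministic inequality. -/
lemma weighted_rank_ineq {m : ℕ} {α : ℝ} (hα : α ∈ Set.Ioo (0 : ℝ) 1)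
    (v : Fin m → ℝ) (p : Fin m → ℝ≥0∞) :
    (∑ k, if ENNReal.ofReal (1 - α) ≤ ∑ i, (if v i < v k then p i / ∑ j, p j else 0)
      then p k else 0) ≤ ENNReal.ofReal α * ∑ j, p j := by
  set S := ∑ j, p j with hS
  have hαpos : ENNReal.ofReal α ≠ 0 := by simpa using hα.1
  by_cases hStop : S = ∞
  · rw [hStop, ENNReal.mul_top hαpos]; exact le_top
  by_cases hS0 : S = 0
  · have h0 : ∀ k, p k = 0 := by
      intro k
      exact (Finset.sum_eq_zero_iff.1 hS0) k (Finset.mem_univ k)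
    simp [h0]
  rw [← Finset.sum_filter]
  set B := Finset.univ.filter fun k =>
    ENNReal.ofReal (1 - α) ≤ ∑ i, (if v i < v k then p i / S else 0) with hB
  rcases B.eq_empty_or_nonempty with he | hne
  · rw [he]; simp
  obtain ⟨k, hk, hmin⟩ := Finset.exists_min_image B v hne
  have hk2 : ENNReal.ofReal (1 - α) ≤ ∑ i, (if v i < v k then p i / S else 0) := by
    simpa [hB] using hk
  rw [← Finset.sum_filter] at hk2
  simp only [div_eq_mul_inv] at hk2
  rw [← Finset.sum_mul, ← div_eq_mul_inv, ENNReal.le_div_iff_mul_le (Or.inl hS0) (Or.inl hStop)] at hk2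
  set T := ∑ i ∈ Finset.univ.filter (fun i => v i < v k), p i with hT
  have hsplit : T + ∑ i ∈ Finset.univ.filter (fun i => ¬ v i < v k), p i = S :=
    Finset.sum_filter_add_sum_filter_not _ _ _
  have hsub : ∑ i ∈ B, p i ≤ ∑ i ∈ Finset.univ.filter (fun i => ¬ v i < v k), p i := by
    apply Finset.sum_le_sum_of_subset
    intro i hi
    simp [hmin i hi]
  refine hsub.trans ?_
  have hone : ENNReal.ofReal (1 - α) * S + ENNReal.ofReal α * S = S := by
    rw [← add_mul, ← ENNReal.ofReal_add (by linarith [hα.2]) hα.1.le]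
    simp
  have hfin : ENNReal.ofReal (1 - α) * S ≠ ∞ := ENNReal.mul_ne_top ENNReal.ofReal_ne_top hStop
  rw [← ENNReal.add_le_add_iff_left hfin, hone, ← hsplit]
  gcongr
  rwa [hsplit]

/-- Bad event. -/
def badSet {𝒳 : Type*} (α : ℝ) (w : 𝒳 → ℝ≥0∞) (n : ℕ) (qlo qhi : 𝒳 → ℝ) :
    Set ((Fin n → 𝒳 × ℝ) × (𝒳 × ℝ)) :=
  {ω | ENNReal.ofReal (1 - α) ≤ ∑ i, if score qlo qhi (ω.1 i) < score qlo qhi ω.2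
           then w (ω.1 i).1 / ((∑ j, w (ω.1 j).1) + w ω.2.1) else 0}

lemma measurable_score {𝒳 : Type*} [MeasurableSpace 𝒳] {qlo qhi : 𝒳 → ℝ}
    (hqlo : Measurable qlo) (hqhi : Measurable qhi) : Measurable (score qlo qhi) := by
  unfold score
  fun_prop

lemma measurableSet_badSet {𝒳 : Type*} [MeasurableSpace 𝒳] (α : ℝ) {w : 𝒳 → ℝ≥0∞}
    (hw : Measurable w) (n : ℕ) {qlo qhi : 𝒳 → ℝ}
    (hqlo : Measurable qlo) (hqhi : Measurable qhi) :
    MeasurableSet (badSet α w n qlo qhi) := by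
  have hs := measurable_score hqlo hqhi
  refine measurableSet_le measurable_const (Finset.measurable_sum _ fun i _ => ?_)
  refine Measurable.ite (measurableSet_lt ?_ ?_) ?_ measurable_const
  · fun_prop
  · fun_prop
  · refine Measurable.div (by fun_prop) (Measurable.add (Finset.measurable_sum _ fun j _ => ?_) ?_) <;> fun_prop

/-- Exchangeability step. -/
lemma exchangeable_bound {𝒳 : Type*} [MeasurableSpace 𝒳] (R : Measure (𝒳 × ℝ))
    [IsProbabilityMeasure R] {α : ℝ} (hα : α ∈ Set.Ioo (0 : ℝ) 1)
    {qlo qhi : 𝒳 → ℝ} (hqlo : Measurable qlo) (hqhi : Measurable qhi)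
    {w : 𝒳 → ℝ≥0∞} (hw : Measurable w) (n : ℕ) :
    ∫⁻ q, (if (q.2, q.1) ∈ badSet α w n qlo qhi then w q.1.1 else 0)
        ∂(R.prod (Measure.pi fun _ : Fin n => R))
      ≤ ENNReal.ofReal α * ∫⁻ z, w z.1 ∂(R) := by
  set I := ∫⁻ q, (if (q.2, q.1) ∈ badSet α w n qlo qhi then w q.1.1 else 0)
        ∂(R.prod (Measure.pi fun _ : Fin n => R)) with hI
  have hmeas : Measurable fun q : (𝒳 × ℝ) × (Fin n → 𝒳 × ℝ) =>
      (if (q.2, q.1) ∈ badSet α w n qlo qhi then w q.1.1 else 0) := by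
    refine Measurable.ite ?_ (by fun_prop) measurable_const
    exact (measurableSet_badSet α hw n hqlo hqhi).preimage measurable_swap
  have hk : ∀ k : Fin (n + 1), I = ∫⁻ ω, (if ENNReal.ofReal (1 - α) ≤
      ∑ i, (if score qlo qhi (ω i) < score qlo qhi (ω k)
        then w (ω i).1 / ∑ j, w (ω j).1 else 0) then w (ω k).1 else 0)
      ∂(Measure.pi fun _ : Fin (n + 1) => R) := by
    intro k
    have hmp := measurePreserving_piFinSuccAbove (fun _ : Fin (n + 1) => R) k
    rw [hI, ← hmp.lintegral_comp hmeas]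
    refine lintegral_congr fun ω => ?_
    have hsum : ∑ j, w (ω j).1 = (∑ j, w (ω (k.succAbove j)).1) + w (ω k).1 := by
      rw [Fin.sum_univ_succAbove _ k, add_comm]
    rw [Fin.sum_univ_succAbove (fun i => if score qlo qhi (ω i) < score qlo qhi (ω k)
        then w (ω i).1 / ∑ j, w (ω j).1 else 0) k, if_neg (lt_irrefl _), zero_add, hsum]
    refine if_congr Iff.rfl rfl rfl
  have hsumI : ((n + 1 : ℕ) : ℝ≥0∞) * I ≤
      ((n + 1 : ℕ) : ℝ≥0∞) * (ENNReal.ofReal α * ∫⁻ z, w z.1 ∂(R)) := by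
    have h1 : ((n + 1 : ℕ) : ℝ≥0∞) * I = ∑ k : Fin (n + 1), I := by simp
    have hs := measurable_score hqlo hqhi
    rw [h1, Finset.sum_congr rfl fun k _ => hk k, ← lintegral_finsetSum]
    · calc _ ≤ ∫⁻ ω, ENNReal.ofReal α * ∑ j, w (ω j).1
              ∂(Measure.pi fun _ : Fin (n + 1) => R) := by
            refine lintegral_mono fun ω => ?_
            exact weighted_rank_ineq hα (fun i => score qlo qhi (ω i)) (fun i => w (ω i).1)
        _ = _ := by
            rw [lintegral_const_mul _ (Finset.measurable_sum _ fun j _ => by fun_prop),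
              lintegral_finsetSum _ (fun j _ => by fun_prop)]
            have : ∀ j : Fin (n + 1), ∫⁻ ω, w (ω j).1
                ∂(Measure.pi fun _ : Fin (n + 1) => R) = ∫⁻ z, w z.1 ∂(R) := fun j =>
              (measurePreserving_eval (fun _ : Fin (n + 1) => R) j).lintegral_comp
                (f := fun z : 𝒳 × ℝ => w z.1) (by fun_prop)
            simp only [this, Finset.sum_const, Finset.card_univ, Fintype.card_fin, nsmul_eq_mul]
            ring
    · intro k _
      refine Measurable.ite (measurableSet_le measurable_const
        (Finset.measurable_sum _ fun i _ => ?_)) (by fun_prop) measurable_const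
      refine Measurable.ite (measurableSet_lt (by fun_prop) (by fun_prop)) ?_ measurable_const
      exact Measurable.div (by fun_prop) (Finset.measurable_sum _ fun j _ => by fun_prop)
  exact (ENNReal.mul_le_mul_iff_right (by simp) (by simp)).1 hsumI

lemma badSet_bound {𝒳 : Type*} [MeasurableSpace 𝒳]
    (P Q : Measure 𝒳) [IsProbabilityMeasure P] [IsProbabilityMeasure Q]
    (K : Kernel 𝒳 ℝ) [IsMarkovKernel K]
    (α : ℝ) (hα : α ∈ Set.Ioo (0 : ℝ) 1)
    (qlo qhi : 𝒳 → ℝ) (hqlo : Measurable qlo) (hqhi : Measurable qhi)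
    (w : 𝒳 → ℝ≥0∞) (hw : Measurable w)
    (hwP : ∀ᵐ x ∂P, w x = Q.rnDeriv P x)
    (hwsing : ∀ᵐ x ∂(Q.singularPart P), w x = ∞)
    (n : ℕ) :
    ((Measure.pi fun _ : Fin n => P ⊗ₘ K).prod (Q ⊗ₘ K)) (badSet α w n qlo qhi)
      ≤ ENNReal.ofReal α := by
  have hB := measurableSet_badSet α hw n hqlo hqhi
  set R := P ⊗ₘ K with hR
  set π := Measure.pi fun _ : Fin n => R with hπ
  set G : 𝒳 × ℝ → ℝ≥0∞ := fun z => π ((fun d => (d, z)) ⁻¹' badSet α w n qlo qhi) with hG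
  have hGm : Measurable G := measurable_measure_prodMk_right hB
  have hGtop : ∀ x y, w x = ∞ → G (x, y) = 0 := by
    intro x y hx
    have : ((fun d => (d, (x, y))) ⁻¹' badSet α w n qlo qhi) = ∅ := by
      ext d
      have hp : ¬ (1 - α ≤ 0) := by linarith [hα.2]
      simp [badSet, hx, hp]
    simp only [hG, this, measure_empty]
  set H : 𝒳 → ℝ≥0∞ := fun x => ∫⁻ y, G (x, y) ∂(K x) with hH
  have hHm : Measurable H := hGm.lintegral_kernel_prod_right'
  have hwR : ∫⁻ z, w z.1 ∂(R) = ∫⁻ x, w x ∂P := by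
    rw [hR, Measure.lintegral_compProd (by fun_prop)]
    simp
  have hw1 : ∫⁻ x, w x ∂P ≤ 1 := by
    rw [lintegral_congr_ae hwP]
    exact Measure.lintegral_rnDeriv_le.trans prob_le_one
  calc (π.prod (Q ⊗ₘ K)) (badSet α w n qlo qhi)
      = ∫⁻ z, G z ∂(Q ⊗ₘ K) := Measure.prod_apply_symm hB
    _ = ∫⁻ x, H x ∂Q := Measure.lintegral_compProd hGm
    _ = ∫⁻ x, H x ∂(Q.singularPart P) + ∫⁻ x, H x ∂(P.withDensity (Q.rnDeriv P)) := by
        rw [← lintegral_add_measure, Measure.singularPart_add_rnDeriv]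
    _ = ∫⁻ x, H x ∂(P.withDensity (Q.rnDeriv P)) := by
        have : ∫⁻ x, H x ∂(Q.singularPart P) = 0 := by
          rw [lintegral_eq_zero_iff hHm]
          filter_upwards [hwsing] with x hx
          simp [hH, hGtop x _ hx]
        rw [this, zero_add]
    _ = ∫⁻ x, w x * H x ∂P := by
        rw [lintegral_withDensity_eq_lintegral_mul _ (Measure.measurable_rnDeriv Q P) hHm]
        refine lintegral_congr_ae ?_
        filter_upwards [hwP] with x hx
        simp [hx]
    _ = ∫⁻ z, w z.1 * G z ∂(R) := by
        rw [hR, Measure.lintegral_compProd (by fun_prop)]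
        refine lintegral_congr fun x => ?_
        simp only [hH]
        rw [lintegral_const_mul _ (by fun_prop)]
    _ = ∫⁻ q, (if (q.2, q.1) ∈ badSet α w n qlo qhi then w q.1.1 else 0) ∂(R.prod π) := by
        rw [lintegral_prod]
        · refine lintegral_congr fun z => ?_
          have hm : MeasurableSet ((fun d => (d, z)) ⁻¹' badSet α w n qlo qhi) :=
            hB.preimage measurable_prodMk_right
          exact (lintegral_indicator_const hm (w z.1)).symm
        · refine (Measurable.ite ?_ (by fun_prop) measurable_const).aemeasurable
          exact hB.preimage measurable_swap
    _ ≤ ENNReal.ofReal α * ∫⁻ z, w z.1 ∂(R) := exchangeable_bound R hα hqlo hqhi hw n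
    _ ≤ ENNReal.ofReal α * 1 := by rw [hwR]; gcongr
    _ = _ := mul_one _

end ConformalCausal

/-- Proposition 1 (1): if the weight function used in weighted split-CQR
is the true likelihood ratio `w = dQ_X/dP_X` (a version of the Radon–Nikodym derivative of
the absolutely continuous part of `Q` w.r.t. `P`, set to `∞` on a `P`-null set carrying the
singular part of `Q`), then with no further assumption the weighted split-CQR interval
satisfies `P_{(X,Y) ~ Q_X × P_{Y|X}} (Y ∈ Ĉ(X)) ≥ 1 − α`, the probability being over both
the i.i.d. calibration sample from `P_X × P_{Y|X}` and the independent test pair. -/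
theorem weighted_split_CQR_coverage
    {𝒳 : Type*} [MeasurableSpace 𝒳]
    (P Q : Measure 𝒳) [IsProbabilityMeasure P] [IsProbabilityMeasure Q]
    (K : Kernel 𝒳 ℝ) [IsMarkovKernel K]
    (α : ℝ) (hα : α ∈ Set.Ioo (0 : ℝ) 1)
    (qlo qhi : 𝒳 → ℝ) (hqlo : Measurable qlo) (hqhi : Measurable qhi)
    (w : 𝒳 → ℝ≥0∞) (hw : Measurable w)
    (hwP : ∀ᵐ x ∂P, w x = Q.rnDeriv P x)
    (hwsing : ∀ᵐ x ∂(Q.singularPart P), w x = ∞)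
    (n : ℕ) :
    ENNReal.ofReal (1 - α) ≤
      ((Measure.pi fun _ : Fin n => P ⊗ₘ K).prod (Q ⊗ₘ K))
        {ω : (Fin n → 𝒳 × ℝ) × (𝒳 × ℝ) |
          ω.2.2 ∈ ConformalCausal.Chat α w ω.1 qlo qhi ω.2.1} := by
  have hset : {ω : (Fin n → 𝒳 × ℝ) × (𝒳 × ℝ) |
      ω.2.2 ∈ ConformalCausal.Chat α w ω.1 qlo qhi ω.2.1} =
      (ConformalCausal.badSet α w n qlo qhi)ᶜ := by
    ext ω
    exact ConformalCausal.mem_Chat_iff hα.2 w ω.1 qlo qhi ω.2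
  rw [hset, prob_compl_eq_one_sub (ConformalCausal.measurableSet_badSet α hw n hqlo hqhi),
    ENNReal.ofReal_sub _ hα.1.le, ENNReal.ofReal_one]
  exact tsub_le_tsub_left
    (ConformalCausal.badSet_bound P Q K α hα qlo qhi hqlo hqhi w hw hwP hwsing n) 1
end

section
/- Conformal inference for interval outcomes: let (X_i, C_i), i = 1, …, n, and (X, C) be i.i.d., where C_i = [C_i^L, C_i^R] is a random closed interval (C_i^L ≤ C_i^R), and let m^L, m^R : 𝒳 → ℝ be fixed measurable functions (fitted on an independent training fold). Define scores V_i = max{m^L(X_i) − C_i^L, C_i^R − m^R(X_i)}, let η be the (1 − γ)(1 + 1/n)-th empirical quantile of {V_1, …, V_n}, and set 𝒞̂(x) = [m^L(x) − η, m^R(x) + η]. Then P(C ⊆ 𝒞̂(X)) ≥ 1 − γ. -/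
open MeasureTheory ProbabilityTheory
open scoped Classical

namespace ConformalCausal

/-- The non-conformity score of an interval outcome `(x, (cL, cR))`:
`V = max (m^L(x) − cL, cR − m^R(x))`. -/
noncomputable def intScore {𝒳 : Type*} (mL mR : 𝒳 → ℝ) (p : 𝒳 × ℝ × ℝ) : ℝ :=
  max (mL p.1 - p.2.1) (p.2.2 - mR p.1)

/-- The set `{z ∈ ℝ : (1/n)·#{i : V_i ≤ z} ≥ (1 − γ)(1 + 1/n)}`; its infimum is the
conformity correction `η` (`+∞`, i.e. `𝒞̂ = ℝ`, when the set is empty, which happens in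
particular when `(1 − γ)(1 + 1/n) > 1`). -/
noncomputable def intQSet {𝒳 : Type*} (γ : ℝ) {n : ℕ} (mL mR : 𝒳 → ℝ)
    (d : Fin n → 𝒳 × ℝ × ℝ) : Set ℝ :=
  {z | (1 - γ) * (1 + 1 / (n : ℝ)) ≤
    ((Finset.univ.filter fun i => intScore mL mR (d i) ≤ z).card : ℝ) / (n : ℝ)}

end ConformalCausal

namespace ConformalCausal

/-- Rank-type event: the number of `d i` with score strictly below that of `y` is `< t`. -/
def rankSet {Y : Type*} (s : Y → ℝ) (t : ℝ) (n : ℕ) : Set (Y × (Fin n → Y)) :=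
  {q | (∑ i, if s (q.2 i) < s q.1 then (1 : ℝ) else 0) < t}

theorem measurableSet_rankSet {Y : Type*} [MeasurableSpace Y] (s : Y → ℝ) (hs : Measurable s)
    (t : ℝ) (n : ℕ) : MeasurableSet (rankSet s t n) := by
  unfold rankSet
  refine measurableSet_lt (Finset.measurable_sum _ fun i _ => ?_) measurable_const
  refine Measurable.ite ?_ measurable_const measurable_const
  exact measurableSet_lt (hs.comp ((measurable_pi_apply i).comp measurable_snd))
    (hs.comp measurable_fst)

/-- Deterministic counting: at least `t` indices have strict rank below `t`. -/
theorem count_rank {m : ℕ} (v : Fin m → ℝ) (t : ℝ) (ht : t ≤ m) :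
    t ≤ ((Finset.univ.filter fun j =>
      ((Finset.univ.filter fun i => v i < v j).card : ℝ) < t).card : ℝ) := by
  by_cases hB : (Finset.univ.filter fun j =>
      ¬ ((Finset.univ.filter fun i => v i < v j).card : ℝ) < t).Nonempty
  · obtain ⟨j, hj, hmin⟩ := Finset.exists_min_image _ v hB
    have hj' := (Finset.mem_filter.1 hj).2
    refine (not_lt.1 hj').trans ?_
    norm_cast
    refine Finset.card_le_card fun i hi => ?_
    have hi' := (Finset.mem_filter.1 hi).2
    refine Finset.mem_filter.2 ⟨Finset.mem_univ _, ?_⟩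
    by_contra hcon
    exact absurd (hmin i (Finset.mem_filter.2 ⟨Finset.mem_univ _, hcon⟩)) (not_le.2 hi')
  · rw [Finset.not_nonempty_iff_eq_empty, Finset.filter_eq_empty_iff] at hB
    rw [Finset.filter_true_of_mem (fun j hj => not_not.1 (hB hj))]
    simpa using ht

theorem rank_prob {Y : Type*} [MeasurableSpace Y] (ν : Measure Y) [IsProbabilityMeasure ν]
    (s : Y → ℝ) (hs : Measurable s) (n : ℕ) (c : ℝ) (hc : c ≤ 1) :
    ENNReal.ofReal c ≤
      (ν.prod (Measure.pi fun _ : Fin n => ν)) (rankSet s (c * (n + 1)) n) := by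
  set H := rankSet s (c * (n + 1)) n with hH
  have hHm : MeasurableSet H := measurableSet_rankSet s hs _ n
  let e := fun j : Fin (n + 1) => MeasurableEquiv.piFinSuccAbove (fun _ : Fin (n + 1) => Y) j
  have hmp := fun j : Fin (n + 1) => measurePreserving_piFinSuccAbove (fun _ : Fin (n + 1) => ν) j
  have hG : ∀ j, (Measure.pi fun _ : Fin (n + 1) => ν) (e j ⁻¹' H)
      = (ν.prod (Measure.pi fun _ : Fin n => ν)) H := fun j =>
    (hmp j).measure_preimage hHm.nullMeasurableSet
  have hGm : ∀ j, MeasurableSet (e j ⁻¹' H) := fun j => (e j).measurable hHm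
  have hmem : ∀ j w, w ∈ e j ⁻¹' H ↔
      ((Finset.univ.filter fun i => s (w i) < s (w j)).card : ℝ) < c * (n + 1) := by
    intro j w
    have h1 : ((Finset.univ.filter fun i => s (w i) < s (w j)).card : ℝ)
        = ∑ i, if s (w i) < s (w j) then (1 : ℝ) else 0 := by
      simp
    rw [h1, Fin.sum_univ_succAbove _ j]
    simp only [lt_irrefl, if_false, zero_add]
    rfl
  have hsum : ENNReal.ofReal (c * (n + 1)) ≤
      ∑ j : Fin (n + 1), (Measure.pi fun _ : Fin (n + 1) => ν) (e j ⁻¹' H) := by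
    calc ENNReal.ofReal (c * (n + 1))
        = ∫⁻ _, ENNReal.ofReal (c * (n + 1)) ∂(Measure.pi fun _ : Fin (n + 1) => ν) := by simp
      _ ≤ ∫⁻ w, ∑ j, (e j ⁻¹' H).indicator 1 w ∂(Measure.pi fun _ : Fin (n + 1) => ν) := by
          refine lintegral_mono fun w => ?_
          have h2 : (∑ j, (e j ⁻¹' H).indicator (1 : (Fin (n + 1) → Y) → ENNReal) w) =
              ((Finset.univ.filter fun j =>
                ((Finset.univ.filter fun i => s (w i) < s (w j)).card : ℝ)
                  < c * (n + 1)).card : ENNReal) := by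
            simp only [Set.indicator_apply, hmem, Pi.one_apply, Finset.sum_boole]
          simp only [h2]
          rw [← ENNReal.ofReal_natCast]
          refine ENNReal.ofReal_le_ofReal (count_rank (fun i => s (w i)) _ ?_)
          push_cast
          nlinarith [(Nat.cast_nonneg n : (0 : ℝ) ≤ n)]
      _ = _ := by
          rw [lintegral_finsetSum _ fun j _ => measurable_one.indicator (hGm j)]
          exact Finset.sum_congr rfl fun j _ => lintegral_indicator_one (hGm j)
  simp only [hG, Finset.sum_const, Finset.card_univ, Fintype.card_fin, nsmul_eq_mul] at hsum
  rw [mul_comm c, ENNReal.ofReal_mul (by positivity)] at hsum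
  have h3 : ENNReal.ofReal ((n : ℝ) + 1) = ((n + 1 : ℕ) : ENNReal) := by
    rw [← ENNReal.ofReal_natCast]; push_cast; rfl
  rw [h3] at hsum
  exact (ENNReal.mul_le_mul_iff_right (by simp) (ENNReal.natCast_ne_top _)).1 hsum

end ConformalCausal

/-- Theorem 3.2, conformal inference for interval outcomes: let
`(X_i, C_i)`, `i = 1, …, n`, and `(X, C)` be i.i.d., where `C_i = [C_i^L, C_i^R]` is a
random closed interval, and let `m^L, m^R : 𝒳 → ℝ` be fixed measurable functions.  With
scores `V_i = max(m^L(X_i) − C_i^L, C_i^R − m^R(X_i))`, `η` the `(1 − γ)(1 + 1/n)`-th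
empirical quantile of `{V_1, …, V_n}` and `𝒞̂(x) = [m^L(x) − η, m^R(x) + η]` (all of `ℝ`
when the empirical quantile is `+∞`), we have `P(C ⊆ 𝒞̂(X)) ≥ 1 − γ`. -/
theorem conformal_interval_outcomes
    {𝒳 : Type*} [MeasurableSpace 𝒳]
    -- the common law of `(X, C^L, C^R)`, a random closed interval attached to covariates
    (ν : Measure (𝒳 × ℝ × ℝ)) [IsProbabilityMeasure ν]
    (hint : ∀ᵐ p ∂ν, p.2.1 ≤ p.2.2)
    (γ : ℝ) (hγ : γ ∈ Set.Ioo (0 : ℝ) 1)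
    (mL mR : 𝒳 → ℝ) (hmL : Measurable mL) (hmR : Measurable mR)
    (n : ℕ) (hn : 0 < n) :
    ENNReal.ofReal (1 - γ) ≤
      ((Measure.pi fun _ : Fin n => ν).prod ν)
        {ω : (Fin n → 𝒳 × ℝ × ℝ) × (𝒳 × ℝ × ℝ) |
          if (ConformalCausal.intQSet γ mL mR ω.1).Nonempty then
            mL ω.2.1 - sInf (ConformalCausal.intQSet γ mL mR ω.1) ≤ ω.2.2.1 ∧
              ω.2.2.2 ≤ mR ω.2.1 + sInf (ConformalCausal.intQSet γ mL mR ω.1)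
          else True} := by
  have hs : Measurable (ConformalCausal.intScore mL mR) := by
    unfold ConformalCausal.intScore
    fun_prop
  have hp := ConformalCausal.rank_prob ν _ hs n (1 - γ) (by linarith [hγ.1])
  have hm := ConformalCausal.measurableSet_rankSet _ hs ((1 - γ) * (n + 1)) n
  rw [← (Measure.measurePreserving_swap (μ := Measure.pi fun _ : Fin n => ν)
    (ν := ν)).measure_preimage hm.nullMeasurableSet] at hp
  refine hp.trans (measure_mono ?_)
  rintro ⟨d, y⟩ h
  simp only [Set.mem_preimage, Prod.swap_prod_mk, ConformalCausal.rankSet,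
    Set.mem_ofPred_eq, Finset.sum_boole] at h
  simp only [Set.mem_ofPred_eq]
  split_ifs with hne
  · have hle : ConformalCausal.intScore mL mR y ≤ sInf (ConformalCausal.intQSet γ mL mR d) := by
      refine le_csInf hne fun z hz => ?_
      by_contra hlt
      rw [not_le] at hlt
      simp only [ConformalCausal.intQSet, Set.mem_ofPred_eq] at hz
      have hn' : (0 : ℝ) < n := by exact_mod_cast hn
      rw [le_div_iff₀ hn'] at hz
      have h1 : (1 - γ) * (1 + 1 / (n : ℝ)) * n = (1 - γ) * (n + 1) := by
        field_simp
      rw [h1] at hz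
      have h2 := hz.trans_lt' h
      norm_cast at h2
      refine absurd h2 (not_lt.2 (Finset.card_le_card fun i hi => ?_))
      simp only [Finset.mem_filter, Finset.mem_univ, true_and] at hi ⊢
      exact hi.trans_lt hlt
    have h1 := (le_max_left _ _).trans hle
    have h2 := (le_max_right _ _).trans hle
    constructor <;> linarith
end

section
/- Nested ITE interval validity: under the potential outcome framework, let Ĉ_1 and Ĉ_0 be set-valued maps (counterfactual intervals, fitted on an independent first fold) and for a unit with data (X, T, Y^obs) define the induced interval Ĉ = Y(1) − Ĉ_0(X) = {Y(1) − c : c ∈ Ĉ_0(X)} if T = 1, and Ĉ = Ĉ_1(X) − Y(0) = {c − Y(0) : c ∈ Ĉ_1(X)} if T = 0. If P(Y(0) ∈ Ĉ_0(X) | T = 1) ≥ 1 − α and P(Y(1) ∈ Ĉ_1(X) | T = 0) ≥ 1 − α, then P(Y(1) − Y(0) ∈ Ĉ) ≥ 1 − α. -/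
open MeasureTheory ProbabilityTheory
open scoped Classical

/-- validity of the nested ITE intervals, Eq. (24)–(25): under the
potential outcome framework, let `Ĉ₁, Ĉ₀` be set-valued maps fitted independently of the
data, and for a unit `(X, T, Y^obs)` define the induced interval
`Ĉ = Y(1) − Ĉ₀(X)` when `T = 1` and `Ĉ = Ĉ₁(X) − Y(0)` when `T = 0` (recall
`Y^obs = Y(T)`).  If `P(Y(0) ∈ Ĉ₀(X) | T = 1) ≥ 1 − α` and
`P(Y(1) ∈ Ĉ₁(X) | T = 0) ≥ 1 − α`, then `P(Y(1) − Y(0) ∈ Ĉ) ≥ 1 − α`. -/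
theorem nested_ITE_interval_coverage
    {Ω 𝒳 : Type*} [MeasurableSpace Ω] [MeasurableSpace 𝒳]
    (μ : Measure Ω) [IsProbabilityMeasure μ]
    -- the potential outcomes, the treatment indicator and the covariates
    (Y1 Y0 : Ω → ℝ) (T : Ω → Bool) (X : Ω → 𝒳)
    (hY1 : Measurable Y1) (hY0 : Measurable Y0) (hX : Measurable X)
    (hT : MeasurableSet {ω | T ω = true})
    -- `0 < P(T = 1) < 1`
    (hT1 : 0 < μ {ω | T ω = true}) (hT1' : μ {ω | T ω = true} < 1)
    -- the counterfactual intervals, with measurable coverage events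
    (C1 C0 : 𝒳 → Set ℝ)
    (hmeas0 : MeasurableSet {ω | Y0 ω ∈ C0 (X ω)})
    (hmeas1 : MeasurableSet {ω | Y1 ω ∈ C1 (X ω)})
    (α : ℝ) (hα : α ∈ Set.Ioo (0 : ℝ) 1)
    -- the two conditional coverage conditions (Eq. (24))
    (hcov0 : ENNReal.ofReal (1 - α) ≤
      (μ[|{ω | T ω = true}]) {ω | Y0 ω ∈ C0 (X ω)})
    (hcov1 : ENNReal.ofReal (1 - α) ≤
      (μ[|{ω | T ω = false}]) {ω | Y1 ω ∈ C1 (X ω)}) :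
    ENNReal.ofReal (1 - α) ≤
      μ {ω | Y1 ω - Y0 ω ∈
        (if T ω then (fun c => Y1 ω - c) '' C0 (X ω)
         else (fun c => c - Y0 ω) '' C1 (X ω))} := by
  have hF : {ω | T ω = false} = {ω | T ω = true}ᶜ := by
    ext ω; simp
  have hTF : MeasurableSet {ω | T ω = false} := hF ▸ hT.compl
  have h0 := cond_mul_eq_inter hT {ω | Y0 ω ∈ C0 (X ω)} μ
  have h1 := cond_mul_eq_inter hTF {ω | Y1 ω ∈ C1 (X ω)} μ
  have hsum : μ {ω | T ω = true} + μ {ω | T ω = false} = 1 := by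
    rw [hF]; exact prob_add_prob_compl hT
  rw [← measure_inter_add_diff _ hT]
  calc ENNReal.ofReal (1 - α)
      = ENNReal.ofReal (1 - α) * μ {ω | T ω = true}
        + ENNReal.ofReal (1 - α) * μ {ω | T ω = false} := by
          rw [← mul_add, hsum, mul_one]
    _ ≤ μ ({ω | T ω = true} ∩ {ω | Y0 ω ∈ C0 (X ω)})
        + μ ({ω | T ω = false} ∩ {ω | Y1 ω ∈ C1 (X ω)}) := by
          rw [← h0, ← h1]; gcongr
    _ ≤ _ := by
          refine add_le_add (measure_mono ?_) (measure_mono ?_)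
          · rintro ω ⟨ht, hω⟩
            simp only [Set.mem_setOf_eq] at ht hω
            refine ⟨?_, ht⟩
            simp only [Set.mem_setOf_eq, ht, if_true]
            exact ⟨_, hω, rfl⟩
          · rintro ω ⟨ht, hω⟩
            simp only [Set.mem_setOf_eq] at ht hω
            refine ⟨?_, by simp [ht]⟩
            simp only [Set.mem_setOf_eq, ht, Bool.false_eq_true, if_false]
            exact ⟨_, hω, rfl⟩
end
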